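/- Let d ≥ 1, let Γ be an additive subsemigroup of ℕ^d × ℕ with Δ(Γ) compact, and let ε be a positive integer. Define the additive subsemigroup Γ_{≥ε} of ℕ^d × ℕ by Γ_{≥ε} := {(σ₁ − εk, σ₂, …, σ_d, k) : (σ₁, …, σ_d, k) ∈ Γ and σ₁ ≥ εk}. If the hyperplane {x ∈ ℝ^d : x₁ = ε} meets the (topological) interior of Δ(Γ), then Δ(Γ) ∩ {x ∈ ℝ^d : x₁ ≥ ε} = Δ(Γ_{≥ε}) + (ε, 0, …, 0), i.e. the part of Δ(Γ) lying on or beyond the hyperplane is the translate of Δ(Γ_{≥ε}) by ε times the first standard basis vector. -/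

import Mathlib

/-- The set of valuative points of an additive subsemigroup `Γ ⊆ ℕ^d × ℕ`:
points `x ∈ ℝ^d` of the form `σ / k` for some `(σ, k) ∈ Γ` with `k > 0`. -/
def valPoints {d : ℕ} (Γ : AddSubsemigroup ((Fin d → ℕ) × ℕ)) : Set (Fin d → ℝ) :=
  {x | ∃ p ∈ Γ, 0 < p.2 ∧ x = fun i => (p.1 i : ℝ) / (p.2 : ℝ)}

/-- The Newton–Okounkov body of `Γ`: the closure of the convex hull of the set of
valuative points of `Γ`. -/
def NObody {d : ℕ} (Γ : AddSubsemigroup ((Fin d → ℕ) × ℕ)) : Set (Fin d → ℝ) :=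
  closure (convexHull ℝ (valPoints Γ))

/-- The twisted-down semigroup `Γ_{≥ε}`: its elements are the
`(σ₁ − εk, σ₂, …, σ_d, k)` for `(σ₁, …, σ_d, k) ∈ Γ` with `σ₁ ≥ εk`; equivalently,
`(τ, k) ∈ Γ_{≥ε}` iff adding `ε·k` to the first coordinate of `τ` gives an element
of `Γ`.  The ambient dimension is `d + 1`. -/
def twistSemigroup (d ε : ℕ) (Γ : AddSubsemigroup ((Fin (d + 1) → ℕ) × ℕ)) :
    AddSubsemigroup ((Fin (d + 1) → ℕ) × ℕ) where
  carrier := {p | ((p.1 + fun i => if i = 0 then ε * p.2 else 0, p.2) :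
      (Fin (d + 1) → ℕ) × ℕ) ∈ Γ}
  add_mem' := by
    intro p q hp hq
    have h := Γ.add_mem hp hq
    have e : ((p.1 + fun i => if i = 0 then ε * p.2 else 0, p.2) :
          (Fin (d + 1) → ℕ) × ℕ) +
        (q.1 + fun i => if i = 0 then ε * q.2 else 0, q.2) =
        ((p + q).1 + fun i => if i = 0 then ε * (p + q).2 else 0, (p + q).2) := by
      refine Prod.ext ?_ ?_
      · funext i
        by_cases hi : i = 0 <;> simp [hi, mul_add] <;> ring
      · simp
    rwa [e] at h

theorem AddSubsemigroup.nsmul_mem_of_pos {M : Type*} [AddMonoid M] (S : AddSubsemigroup M) {x : M}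
    (hx : x ∈ S) {n : ℕ} (hn : 0 < n) : n • x ∈ S := by
  induction n, hn using Nat.le_induction with
  | base => simpa using hx
  | succ n _ ih => rw [succ_nsmul]; exact S.add_mem ih hx

/-- Valuative points are stable under rational convex combinations. -/
theorem valPoints_ratio_mem {d : ℕ} {Γ : AddSubsemigroup ((Fin d → ℕ) × ℕ)} {x y : Fin d → ℝ}
    (hx : x ∈ valPoints Γ) (hy : y ∈ valPoints Γ) {m r : ℕ} (hm : 0 < m) (hr : 0 < r) :
    ((r : ℝ) / (m + r)) • x + ((m : ℝ) / (m + r)) • y ∈ valPoints Γ := by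
  obtain ⟨⟨σ, k⟩, hp, hk, rfl⟩ := hx
  obtain ⟨⟨τ, l⟩, hq, hl, rfl⟩ := hy
  simp only at hk hl
  refine ⟨(r * l) • (σ, k) + (m * k) • (τ, l),
    Γ.add_mem (Γ.nsmul_mem_of_pos hp (by positivity)) (Γ.nsmul_mem_of_pos hq (by positivity)),
    ?_, ?_⟩
  · simp only [Prod.smul_mk, Prod.mk_add_mk, smul_eq_mul]
    positivity
  · funext i
    have hm' : (0 : ℝ) < m := by exact_mod_cast hm
    have hr' : (0 : ℝ) < r := by exact_mod_cast hr
    have hk' : (0 : ℝ) < k := by exact_mod_cast hk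
    have hl' : (0 : ℝ) < l := by exact_mod_cast hl
    have hs : (r : ℝ) * l * k + m * k * l ≠ 0 := by positivity
    simp only [Prod.smul_mk, Prod.mk_add_mk, smul_eq_mul, Pi.add_apply, Pi.smul_apply]
    push_cast
    field_simp
    ring

theorem segment_subset_closure_valPoints {d : ℕ} {Γ : AddSubsemigroup ((Fin d → ℕ) × ℕ)}
    {x y : Fin d → ℝ} (hx : x ∈ valPoints Γ) (hy : y ∈ valPoints Γ) {t : ℝ}
    (ht : t ∈ Set.Icc (0 : ℝ) 1) : (1 - t) • x + t • y ∈ closure (valPoints Γ) := by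
  have hmem : t ∈ closure (Set.Ioo (0 : ℝ) 1 ∩ Set.range ((↑) : ℚ → ℝ)) := by
    have h := closure_minimal
      (Dense.open_subset_closure_inter (Rat.denseRange_cast (𝕜 := ℝ)) (isOpen_Ioo (a := 0) (b := 1)))
      isClosed_closure
    rw [closure_Ioo zero_ne_one] at h
    exact h ht
  refine map_mem_closure (f := fun t : ℝ => (1 - t) • x + t • y) (by fun_prop) hmem ?_
  rintro _ ⟨⟨h0, h1⟩, q, rfl⟩
  have h0' : 0 < q := by exact_mod_cast h0
  have h1' : q < 1 := by exact_mod_cast h1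
  obtain ⟨m, hm⟩ := Int.eq_ofNat_of_zero_le (Rat.num_pos.2 h0').le
  have hm0 : 0 < m := by
    have := Rat.num_pos.2 h0'
    omega
  have hlt : m < q.den := by
    have := Rat.lt_iff q 1 |>.1 h1'
    simp only [Rat.num_one, Rat.den_one, Nat.cast_one, mul_one, one_mul] at this
    omega
  obtain ⟨r, hr⟩ := Nat.exists_eq_add_of_lt hlt
  have hq : (q : ℝ) = (m : ℝ) / (m + (r + 1 : ℕ)) := by
    rw [Rat.cast_def, hm, hr]
    push_cast
    ring
  have hq' : 1 - (q : ℝ) = ((r + 1 : ℕ) : ℝ) / (m + (r + 1 : ℕ)) := by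
    rw [hq]
    have : (m : ℝ) + (r + 1 : ℕ) ≠ 0 := by positivity
    field_simp
    ring
  simp only [hq']
  rw [hq]
  exact valPoints_ratio_mem hx hy hm0 r.succ_pos

theorem convex_closure_valPoints {d : ℕ} (Γ : AddSubsemigroup ((Fin d → ℕ) × ℕ)) :
    Convex ℝ (closure (valPoints Γ)) := by
  intro x hx y hy a b ha hb hab
  obtain rfl : a = 1 - b := by linarith
  rw [← closure_closure (s := valPoints Γ)]
  exact map_mem_closure₂ (f := fun x y : Fin d → ℝ => (1 - b) • x + b • y) (by fun_prop) hx hy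
    fun u hu v hv => segment_subset_closure_valPoints hu hv ⟨hb, by linarith⟩

theorem NObody_eq_closure_valPoints {d : ℕ} (Γ : AddSubsemigroup ((Fin d → ℕ) × ℕ)) :
    NObody Γ = closure (valPoints Γ) :=
  (closure_minimal (convexHull_min subset_closure (convex_closure_valPoints Γ))
    isClosed_closure).antisymm (closure_mono (subset_convexHull ℝ _))

theorem image_valPoints_twistSemigroup {d : ℕ} (ε : ℕ)
    (Γ : AddSubsemigroup ((Fin (d + 1) → ℕ) × ℕ)) :
    (fun y : Fin (d + 1) → ℝ => y + fun i => if i = 0 then (ε : ℝ) else 0) ''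
      valPoints (twistSemigroup d ε Γ) = valPoints Γ ∩ {x | (ε : ℝ) ≤ x 0} := by
  ext x
  constructor
  · rintro ⟨_, ⟨⟨σ, k⟩, hp, hk, rfl⟩, rfl⟩
    simp only at hk
    have hk' : (0 : ℝ) < k := by exact_mod_cast hk
    refine ⟨⟨_, hp, hk, ?_⟩, ?_⟩
    · funext i
      by_cases hi : i = 0
      · simp [hi]
        field_simp
      · simp [hi]
    · simp only [Set.mem_ofPred_eq, Pi.add_apply, if_true, le_add_iff_nonneg_left]
      positivity
  · rintro ⟨⟨⟨σ, k⟩, hp, hk, rfl⟩, hx⟩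
    simp only at hk
    have hk' : (0 : ℝ) < k := by exact_mod_cast hk
    have hle : ε * k ≤ σ 0 := by
      simp only [Set.mem_ofPred_eq] at hx
      rw [le_div_iff₀ hk'] at hx
      exact_mod_cast hx
    refine ⟨_, ⟨(σ - fun i => if i = 0 then ε * k else 0, k), ?_, hk, rfl⟩, ?_⟩
    · change ((σ - fun i => if i = 0 then ε * k else 0) +
        fun i => if i = 0 then ε * k else 0, k) ∈ Γ
      convert hp using 2
      funext i
      by_cases hi : i = 0
      · subst hi
        simpa using Nat.sub_add_cancel hle
      · simp [hi]
    · funext i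
      by_cases hi : i = 0
      · subst hi
        simp [Nat.cast_sub hle]
        field_simp
        ring
      · simp [hi]

/-- If a convex closure `closure s` has a point in the open half-space `{c < f}`, then cutting by
the closed half-space `{c ≤ f}` commutes with the closure. -/
theorem Convex.closure_inter_halfSpace_ge {E : Type*} [AddCommGroup E] [Module ℝ E]
    [TopologicalSpace E] [IsTopologicalAddGroup E] [ContinuousSMul ℝ E] {s : Set E}
    (hs : Convex ℝ (closure s)) (f : E →L[ℝ] ℝ) {c : ℝ} {w : E} (hw : w ∈ closure s)
    (hcw : c < f w) : closure s ∩ {x | c ≤ f x} = closure (s ∩ {x | c ≤ f x}) := by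
  refine Set.Subset.antisymm ?_ (closure_minimal (Set.inter_subset_inter_left _ subset_closure)
    (isClosed_closure.inter (isClosed_le continuous_const f.continuous)))
  rintro x ⟨hx, hcx⟩
  have h0 : (0 : ℝ) ∈ closure (Set.Ioo (0 : ℝ) 1) := by
    rw [closure_Ioo zero_ne_one]
    simp
  have key := map_mem_closure (f := fun t : ℝ => (1 - t) • x + t • w)
    (t := closure (s ∩ {x | c ≤ f x})) (by fun_prop) h0 ?_
  · simpa using key
  rintro t ⟨ht0, ht1⟩
  have hmem : (1 - t) • x + t • w ∈ closure s :=
    hs hx hw (by linarith) ht0.le (by ring)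
  have hlt : c < f ((1 - t) • x + t • w) := by
    have hcx : c ≤ f x := hcx
    simp only [map_add, map_smul, smul_eq_mul]
    nlinarith
  have hopen : IsOpen {x | c < f x} := isOpen_lt continuous_const f.continuous
  rw [Set.inter_comm]
  exact closure_mono (Set.inter_subset_inter_left s fun y (hy : c < f y) => hy.le)
    (hopen.inter_closure ⟨hlt, hmem⟩)

theorem exists_gt_apply_of_mem_interior {ι : Type*} [DecidableEq ι] {s : Set (ι → ℝ)}
    {z : ι → ℝ} (hz : z ∈ interior s) (i : ι) : ∃ w ∈ s, z i < w i := by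
  have hc : Filter.Tendsto (fun t : ℝ => z + t • Pi.single i (1 : ℝ)) (nhdsWithin 0 (Set.Ioi 0))
      (nhds z) := by
    have : Continuous fun t : ℝ => z + t • Pi.single i (1 : ℝ) := by fun_prop
    simpa using (this.tendsto 0).mono_left nhdsWithin_le_nhds
  obtain ⟨t, ht, ht0⟩ :=
    ((hc.eventually (mem_interior_iff_mem_nhds.1 hz)).and self_mem_nhdsWithin).exists
  exact ⟨_, ht, by simpa using ht0⟩

/-- let `ε` be a positive integer and suppose `Δ(Γ)` is compact and the
hyperplane `{x₁ = ε}` meets the interior of `Δ(Γ)`.  Then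
`Δ(Γ) ∩ {x₁ ≥ ε} = Δ(Γ_{≥ε}) + (ε, 0, …, 0)`.  The ambient dimension is `d + 1 ≥ 1`. -/
theorem NObody_twist_formula {d : ℕ} (ε : ℕ) (hε : 0 < ε)
    (Γ : AddSubsemigroup ((Fin (d + 1) → ℕ) × ℕ))
    (hcpt : IsCompact (NObody Γ))
    (hmeet : ({x : Fin (d + 1) → ℝ | x 0 = (ε : ℝ)} ∩ interior (NObody Γ)).Nonempty) :
    NObody Γ ∩ {x : Fin (d + 1) → ℝ | (ε : ℝ) ≤ x 0} =
      (fun y : Fin (d + 1) → ℝ => y + fun i => if i = 0 then (ε : ℝ) else 0) ''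
        NObody (twistSemigroup d ε Γ) := by
  obtain ⟨z, hz, hzint⟩ := hmeet
  obtain ⟨w, hw, hlt⟩ := exists_gt_apply_of_mem_interior hzint 0
  have hz : z 0 = ε := hz
  rw [hz] at hlt
  rw [NObody_eq_closure_valPoints] at hw ⊢
  rw [NObody_eq_closure_valPoints]
  have himage := (Homeomorph.addRight
    (fun i : Fin (d + 1) => if i = 0 then (ε : ℝ) else 0)).image_closure
    (valPoints (twistSemigroup d ε Γ))
  simp only [Homeomorph.coe_addRight] at himage
  rw [himage, image_valPoints_twistSemigroup]
  exact (convex_closure_valPoints Γ).closure_inter_halfSpace_ge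
    (ContinuousLinearMap.proj (R := ℝ) (φ := fun _ : Fin (d + 1) => ℝ) 0) hw hlt
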